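/- arXiv:2009.10681 — 2 statements merged into one kernel-verified Lean document; each statement's English description precedes it below -/
import Mathlib

section
/- Let n ≥ 1, let (a,b) ⊆ ℝ be an open interval, let λ ∈ ℝ, and let B0, B1 : (a,b) → ℂ^{2n×2n} be such that B0(x) and B1(x) are Hermitian for every x ∈ (a,b). Let V be a ℂ-linear subspace of functions y : (a,b) → ℂ^{2n} such that: (i) every y ∈ V is differentiable with J y'(x) = (B0(x) + λ B1(x)) y(x) for all x ∈ (a,b); (ii) for every y, z ∈ V, the function x ↦ (J y(x), z(x)) tends to 0 as x → b⁻; (iii) for every x ∈ (a,b), the evaluation map y ↦ y(x) is injective on V. Then dim_ℂ V ≤ n; moreover, if dim_ℂ V = n, then for every x ∈ (a,b) the subspace {y(x) : y ∈ V} ⊆ ℂ^{2n} is a Lagrangian subspace of ℂ^{2n}. -/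
open Matrix Set Filter Topology

noncomputable section

/-- The standard `2n × 2n` complex symplectic matrix `J = [[0, -I],[I, 0]]`. -/
def stdJ (n : ℕ) : Matrix (Fin n ⊕ Fin n) (Fin n ⊕ Fin n) ℂ :=
  Matrix.fromBlocks 0 (-1) 1 0

theorem stdJ_conjTranspose (n : ℕ) : (stdJ n)ᴴ = -stdJ n := by
  simp [stdJ, Matrix.fromBlocks_conjTranspose, Matrix.fromBlocks_neg]

theorem stdJ_mul_self (n : ℕ) : stdJ n * stdJ n = -1 := by
  simp [stdJ, Matrix.fromBlocks_multiply, ← Matrix.fromBlocks_one, Matrix.fromBlocks_neg]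

/-- The standard symplectic form is skew-Hermitian. -/
theorem star_dotProduct_stdJ_mulVec (n : ℕ) (u v : (Fin n ⊕ Fin n) → ℂ) :
    star v ⬝ᵥ (stdJ n) *ᵥ u = -(star ((stdJ n) *ᵥ v) ⬝ᵥ u) := by
  rw [Matrix.star_mulVec, stdJ_conjTranspose, Matrix.vecMul_neg, neg_dotProduct, neg_neg,
    Matrix.dotProduct_mulVec]

open scoped ComplexOrder in
/-- An isotropic subspace of `ℂ^{2n}` has dimension at most `n`. -/
theorem finrank_le_of_isotropic (n : ℕ) (ℓ : Submodule ℂ ((Fin n ⊕ Fin n) → ℂ))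
    (hℓ : ∀ u ∈ ℓ, ∀ v ∈ ℓ, star v ⬝ᵥ (stdJ n) *ᵥ u = 0) :
    Module.finrank ℂ ℓ ≤ n := by
  have hinj : Function.Injective (stdJ n).mulVecLin := by
    intro u v huv
    have h := congrArg (fun w => (stdJ n) *ᵥ w) huv
    simpa [Matrix.mulVec_mulVec, stdJ_mul_self, Matrix.neg_mulVec] using h
  have hdisj : Disjoint ℓ (ℓ.map (stdJ n).mulVecLin) := by
    rw [Submodule.disjoint_def]
    rintro u hu ⟨w, hw, rfl⟩
    exact dotProduct_star_self_eq_zero.1 (hℓ w hw _ hu)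
  have hdim := Submodule.finrank_add_finrank_le_of_disjoint hdisj
  rw [← (Submodule.equivMapOfInjective _ hinj ℓ).finrank_eq] at hdim
  simp only [Module.finrank_fintype_fun_eq_card, Fintype.card_sum, Fintype.card_fin] at hdim
  lia

/-- The bracket of two solutions of `J y' = H y` with `H` Hermitian has derivative zero. -/
theorem hasDerivAt_bracket_zero (n : ℕ) (x : ℝ)
    {H : Matrix (Fin n ⊕ Fin n) (Fin n ⊕ Fin n) ℂ} (hH : H.IsHermitian)
    {y z : ℝ → ((Fin n ⊕ Fin n) → ℂ)} {d e : (Fin n ⊕ Fin n) → ℂ}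
    (hy : ∀ i, HasDerivAt (fun t => y t i) (d i) x) (hd : (stdJ n) *ᵥ d = H *ᵥ (y x))
    (hz : ∀ i, HasDerivAt (fun t => z t i) (e i) x) (he : (stdJ n) *ᵥ e = H *ᵥ (z x)) :
    HasDerivAt (fun t => star (z t) ⬝ᵥ (stdJ n) *ᵥ (y t)) 0 x := by
  have hJ : ∀ i, HasDerivAt (fun t => ((stdJ n) *ᵥ (y t)) i) (((stdJ n) *ᵥ d) i) x := by
    intro i
    simp only [Matrix.mulVec, dotProduct]
    exact HasDerivAt.fun_sum fun j _ => (hy j).const_mul (stdJ n i j)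
  have hsum : HasDerivAt (fun t => star (z t) ⬝ᵥ (stdJ n) *ᵥ (y t))
      (∑ i, (star (e i) * ((stdJ n) *ᵥ (y x)) i + star (z x i) * ((stdJ n) *ᵥ d) i)) x :=
    HasDerivAt.fun_sum fun i _ => (hz i).star.mul (hJ i)
  have hval : ∑ i, (star (e i) * ((stdJ n) *ᵥ (y x)) i + star (z x i) * ((stdJ n) *ᵥ d) i)
      = star e ⬝ᵥ (stdJ n) *ᵥ (y x) + star (z x) ⬝ᵥ (stdJ n) *ᵥ d :=
    Finset.sum_add_distrib
  rw [hval, star_dotProduct_stdJ_mulVec, he, hd, Matrix.star_mulVec, hH.eq,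
    ← Matrix.dotProduct_mulVec, neg_add_cancel] at hsum
  exact hsum

/-- A function with zero derivative on `(a,b)` that tends to `0` at `b` vanishes on `(a,b)`. -/
theorem eq_zero_of_hasDerivAt_zero_of_tendsto {a b : ℝ} {f : ℝ → ℂ}
    (hf : ∀ x ∈ Ioo a b, HasDerivAt f 0 x) (hlim : Tendsto f (𝓝[Ioo a b] b) (𝓝 0))
    {x : ℝ} (hx : x ∈ Ioo a b) : f x = 0 := by
  have hconst : ∀ t ∈ Ioo a b, f t = f x := fun t ht =>
    isOpen_Ioo.is_const_of_deriv_eq_zero isPreconnected_Ioo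
      (fun s hs => (hf s hs).differentiableAt.differentiableWithinAt)
      (fun s hs => (hf s hs).deriv) ht hx
  have : (𝓝[Ioo a b] b).NeBot := by
    rw [nhdsWithin_Ioo_eq_nhdsLT (hx.1.trans hx.2)]
    infer_instance
  exact tendsto_nhds_unique
    (tendsto_const_nhds.congr' (eventually_mem_nhdsWithin.mono fun t ht => (hconst t ht).symm)) hlim

/-- A space `V` of solutions of `J y' = (B0 + λ B1) y` on `(a,b)` whose pairwise brackets
`(Jy,z)` tend to `0` as `x → b⁻`, and on which evaluation at each point is injective, has
dimension at most `n`; if the dimension equals `n`, then evaluation at every `x ∈ (a,b)`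
yields a Lagrangian subspace of `ℂ^{2n}`. -/
theorem solution_space_lagrangian
    (n : ℕ) (hn : 1 ≤ n) (a b : ℝ) (hab : a < b) (lam : ℝ)
    (B0 B1 : ℝ → Matrix (Fin n ⊕ Fin n) (Fin n ⊕ Fin n) ℂ)
    (hB0 : ∀ x ∈ Ioo a b, (B0 x).IsHermitian)
    (hB1 : ∀ x ∈ Ioo a b, (B1 x).IsHermitian)
    (V : Submodule ℂ (ℝ → ((Fin n ⊕ Fin n) → ℂ)))
    (hsol : ∀ y ∈ V, ∀ x ∈ Ioo a b, ∃ d : (Fin n ⊕ Fin n) → ℂ,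
      (∀ i, HasDerivAt (fun t => y t i) (d i) x) ∧
      (stdJ n).mulVec d = (B0 x + (lam : ℂ) • B1 x).mulVec (y x))
    (hlim : ∀ y ∈ V, ∀ z ∈ V,
      Tendsto (fun x => star (z x) ⬝ᵥ (stdJ n).mulVec (y x)) (𝓝[Ioo a b] b) (𝓝 0))
    (hinj : ∀ x ∈ Ioo a b, ∀ y ∈ V, ∀ z ∈ V, y x = z x → y = z) :
    Module.rank ℂ V ≤ n ∧
    (Module.rank ℂ V = n → ∀ x ∈ Ioo a b,
      ∃ ℓ : Submodule ℂ ((Fin n ⊕ Fin n) → ℂ),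
        (ℓ : Set ((Fin n ⊕ Fin n) → ℂ)) = (fun y : ℝ → ((Fin n ⊕ Fin n) → ℂ) => y x) '' V ∧
        Module.finrank ℂ ℓ = n ∧
        ∀ u ∈ ℓ, ∀ v ∈ ℓ, star v ⬝ᵥ (stdJ n).mulVec u = 0) := by
  have hbr : ∀ x ∈ Ioo a b, ∀ y ∈ V, ∀ z ∈ V, star (z x) ⬝ᵥ (stdJ n) *ᵥ (y x) = 0 := by
    intro x hx y hy z hz
    refine eq_zero_of_hasDerivAt_zero_of_tendsto (fun t ht => ?_) (hlim y hy z hz) hx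
    obtain ⟨d, hd, hd'⟩ := hsol y hy t ht
    obtain ⟨e, he, he'⟩ := hsol z hz t ht
    have hH : (B0 t + (lam : ℂ) • B1 t).IsHermitian :=
      (hB0 t ht).add ((hB1 t ht).smul (Complex.conj_ofReal lam))
    exact hasDerivAt_bracket_zero n t hH hd hd' he he'
  let ev (x : ℝ) : V →ₗ[ℂ] ((Fin n ⊕ Fin n) → ℂ) := (LinearMap.proj x).comp V.subtype
  have hev : ∀ x ∈ Ioo a b, Function.Injective (ev x) := fun x hx y z h =>
    Subtype.ext (hinj x hx y y.2 z z.2 h)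
  have hiso : ∀ x ∈ Ioo a b, ∀ u ∈ LinearMap.range (ev x), ∀ v ∈ LinearMap.range (ev x),
      star v ⬝ᵥ (stdJ n) *ᵥ u = 0 := by
    rintro x hx _ ⟨y, rfl⟩ _ ⟨z, rfl⟩
    exact hbr x hx y y.2 z z.2
  constructor
  · obtain ⟨x, hx⟩ := nonempty_Ioo.2 hab
    rw [(LinearEquiv.ofInjective (ev x) (hev x hx)).rank_eq, ← Module.finrank_eq_rank]
    exact_mod_cast finrank_le_of_isotropic n _ (hiso x hx)
  · intro hrank x hx
    refine ⟨LinearMap.range (ev x), ?_, ?_, hiso x hx⟩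
    · ext u
      simp [ev]
    · rw [LinearMap.finrank_range_of_inj (hev x hx)]
      exact Module.finrank_eq_of_rank_eq hrank
end
end

section
/- Let n ≥ 1, let (a,b) ⊆ ℝ be an open interval, fix c ∈ (a,b), and let B0, B1 : (a,b) → ℂ^{2n×2n} be continuous with B0(x) and B1(x) Hermitian for every x ∈ (a,b). Fix λ ∈ ℂ with Im λ ≠ 0, and suppose Φ : (a,b) → ℂ^{2n×2n} is differentiable with J Φ'(x) = (B0(x) + λ B1(x)) Φ(x) for all x ∈ (a,b), Φ(c) = I_{2n}, and Φ(x) invertible for every x ∈ (a,b). Define A(x) := (1/(2 Im λ)) Φ(x)* (J/i) Φ(x). Then for every x ∈ (a,b), the Hermitian matrix A(x) is invertible and has exactly n positive eigenvalues and exactly n negative eigenvalues, counted with multiplicity. -/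
open Matrix Set

noncomputable section

/-- The Hermitian matrix `J/i = -iJ`. -/
def stdJi (n : ℕ) : Matrix (Fin n ⊕ Fin n) (Fin n ⊕ Fin n) ℂ :=
  (-Complex.I) • stdJ n

/-- Niessen's matrix `A(x;λ) = (1/(2 Im λ)) Φ(x)* (J/i) Φ(x)`. -/
def calA (n : ℕ) (lam : ℂ) (Φ : ℝ → Matrix (Fin n ⊕ Fin n) (Fin n ⊕ Fin n) ℂ)
    (x : ℝ) : Matrix (Fin n ⊕ Fin n) (Fin n ⊕ Fin n) ℂ :=
  (1 / (2 * (lam.im : ℂ))) • ((Φ x)ᴴ * stdJi n * Φ x)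

open scoped ComplexOrder

/-- If `s • Pᴴ M P` is positive definite for a Hermitian matrix `M`, then `M` has at least as many
eigenvalues of the sign of `s` as `P` has columns. -/
theorem Matrix.IsHermitian.card_le_card_eigenvalues_of_posDef {ι m : Type*} [Fintype ι]
    [DecidableEq ι] [Fintype m] {M : Matrix ι ι ℂ} (hM : M.IsHermitian) (P : Matrix ι m ℂ) (s : ℝ)
    (hP : ((s : ℂ) • (Pᴴ * M * P)).PosDef) :
    Fintype.card m ≤ Nat.card {i // 0 < s * hM.eigenvalues i} := by
  classical
  set Q : Matrix ι m ℂ := star (hM.eigenvectorUnitary : Matrix ι ι ℂ) * P with hQ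
  have hdiag : Pᴴ * M * P =
      Qᴴ * diagonal (fun i => (hM.eigenvalues i : ℂ)) * Q := by
    conv_lhs => rw [hM.spectral_theorem, Unitary.conjStarAlgAut_apply]
    simp only [hQ, conjTranspose_mul, star_eq_conjTranspose, conjTranspose_conjTranspose,
      Matrix.mul_assoc]
    rfl
  have hform (v : m → ℂ) : star v ⬝ᵥ (((s : ℂ) • (Pᴴ * M * P)) *ᵥ v) =
      ((∑ i, s * hM.eigenvalues i * Complex.normSq ((Q *ᵥ v) i) : ℝ) : ℂ) := by
    rw [hdiag, smul_mulVec, ← mulVec_mulVec, ← mulVec_mulVec, dotProduct_smul,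
      dotProduct_mulVec, ← star_mulVec, dotProduct, Finset.smul_sum]
    push_cast
    refine Finset.sum_congr rfl fun i _ => ?_
    rw [mulVec_diagonal, Complex.normSq_eq_conj_mul_self]
    simp only [Pi.star_apply, smul_eq_mul, RCLike.star_def]
    ring
  let f : (m → ℂ) →ₗ[ℂ] ({i // 0 < s * hM.eigenvalues i} → ℂ) :=
    (LinearMap.funLeft ℂ ℂ Subtype.val).comp Q.mulVecLin
  have hf : Function.Injective f := by
    rw [injective_iff_map_eq_zero]
    intro v hv
    by_contra hne
    have hpos := hP.dotProduct_mulVec_pos hne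
    rw [hform, Complex.zero_lt_real] at hpos
    refine hpos.not_ge (Finset.sum_nonpos fun i _ => ?_)
    by_cases hi : 0 < s * hM.eigenvalues i
    · have : (Q *ᵥ v) i = 0 := congrFun hv ⟨i, hi⟩
      simp [this]
    · exact mul_nonpos_of_nonpos_of_nonneg (not_lt.mp hi) (Complex.normSq_nonneg _)
  simpa [Nat.card_eq_fintype_card] using LinearMap.finrank_le_finrank_of_injective hf

theorem stdJi_isHermitian (n : ℕ) : (stdJi n).IsHermitian := by
  simp [Matrix.IsHermitian, stdJi, stdJ, conjTranspose_smul, fromBlocks_conjTranspose,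
    fromBlocks_smul]

theorem stdJi_mul_self (n : ℕ) : stdJi n * stdJi n = 1 := by
  simp [stdJi, stdJ, fromBlocks_smul, fromBlocks_multiply, smul_smul]

/-- The columns `(1, -isI)`, which for `s = ±1` span the `±1`-eigenspaces of `J/i`. -/
def stdJiColumns (n : ℕ) (s : ℝ) : Matrix (Fin n ⊕ Fin n) (Fin n) ℂ :=
  fromRows 1 ((-(s * Complex.I)) • (1 : Matrix (Fin n) (Fin n) ℂ))

theorem conjTranspose_stdJiColumns_mul_stdJi_mul (n : ℕ) (s : ℝ) :
    (stdJiColumns n s)ᴴ * stdJi n * stdJiColumns n s = ((2 * s : ℝ) : ℂ) • 1 := by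
  rw [stdJiColumns, conjTranspose_fromRows_eq_fromCols_conjTranspose, Matrix.mul_assoc, stdJi,
    stdJ, Matrix.smul_mul, fromBlocks_mul_fromRows, Matrix.mul_smul, fromCols_mul_fromRows]
  ext i j
  by_cases h : i = j
  · subst h
    simp
    linear_combination (-2 * (s : ℂ)) * Complex.I_mul_I
  · simp [h]

theorem calA_isHermitian (n : ℕ) (lam : ℂ) (Φ : ℝ → Matrix (Fin n ⊕ Fin n) (Fin n ⊕ Fin n) ℂ)
    (x : ℝ) : (calA n lam Φ x).IsHermitian := by
  have h := isHermitian_conjTranspose_mul_mul (Φ x) (stdJi_isHermitian n)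
  rw [Matrix.IsHermitian, calA, conjTranspose_smul, h.eq]
  simp

theorem calA_isUnit (n : ℕ) {lam : ℂ} (hlam : lam.im ≠ 0)
    {Φ : ℝ → Matrix (Fin n ⊕ Fin n) (Fin n ⊕ Fin n) ℂ} {x : ℝ} (hΦ : IsUnit (Φ x)) :
    IsUnit (calA n lam Φ x) := by
  have hc : IsUnit (1 / (2 * (lam.im : ℂ))) := by simp [hlam]
  have hJ : IsUnit (stdJi n) := IsUnit.of_mul_eq_one _ (stdJi_mul_self n)
  have h := (hΦ.star.mul hJ).mul hΦ
  rw [calA, ← hc.unit_spec]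
  exact h.smul hc.unit

/-- For invertible `Φ x`, at least `n` eigenvalues of `calA n lam Φ x` have the sign of
`s * Im lam`. -/
theorem le_card_eigenvalues_calA (n : ℕ) {lam : ℂ} (hlam : lam.im ≠ 0)
    {Φ : ℝ → Matrix (Fin n ⊕ Fin n) (Fin n ⊕ Fin n) ℂ} {x : ℝ} (hΦ : IsUnit (Φ x))
    (h : (calA n lam Φ x).IsHermitian) {s : ℝ} (hs : s ≠ 0) :
    n ≤ Nat.card {i // 0 < s * lam.im * h.eigenvalues i} := by
  set P := stdJiColumns n s with hP
  have hdet : IsUnit (Φ x).det := (isUnit_iff_isUnit_det _).mp hΦ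
  have hcancel : Φ x * ((Φ x)⁻¹ * P) = P := mul_nonsing_inv_cancel_left _ _ hdet
  have hform : ((s * lam.im : ℝ) : ℂ) •
      (((Φ x)⁻¹ * P)ᴴ * calA n lam Φ x * ((Φ x)⁻¹ * P)) = ((s ^ 2 : ℝ) : ℂ) • 1 := by
    have key : ((Φ x)⁻¹ * P)ᴴ * ((Φ x)ᴴ * stdJi n * Φ x) * ((Φ x)⁻¹ * P) = Pᴴ * stdJi n * P := by
      conv_rhs => rw [← hcancel]
      simp only [conjTranspose_mul, Matrix.mul_assoc]
    have hlam' : (lam.im : ℂ) ≠ 0 := by exact_mod_cast hlam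
    rw [calA, Matrix.mul_smul, Matrix.smul_mul, key, hP, conjTranspose_stdJiColumns_mul_stdJi_mul,
      smul_smul, smul_smul]
    congr 1
    push_cast
    field_simp
  have hpos : (((s ^ 2 : ℝ) : ℂ) • (1 : Matrix (Fin n) (Fin n) ℂ)).PosDef :=
    Matrix.PosDef.one.smul (Complex.zero_lt_real.mpr (by positivity))
  rw [← hform] at hpos
  simpa only [Fintype.card_fin] using h.card_le_card_eigenvalues_of_posDef _ _ hpos

/-- Signature persistence: for every `x ∈ (a,b)`, the Hermitian matrix `A(x;λ)` is
invertible with exactly `n` positive and `n` negative eigenvalues (with multiplicity). -/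
theorem calA_signature
    (n : ℕ) (hn : 1 ≤ n) (a b : ℝ) (hab : a < b)
    (B0 B1 : ℝ → Matrix (Fin n ⊕ Fin n) (Fin n ⊕ Fin n) ℂ)
    (hB0c : ∀ i j, ContinuousOn (fun x => B0 x i j) (Ioo a b))
    (hB1c : ∀ i j, ContinuousOn (fun x => B1 x i j) (Ioo a b))
    (hB0 : ∀ x ∈ Ioo a b, (B0 x).IsHermitian)
    (hB1 : ∀ x ∈ Ioo a b, (B1 x).IsHermitian)
    (c : ℝ) (hc : c ∈ Ioo a b) (lam : ℂ) (hlam : lam.im ≠ 0)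
    (Φ DΦ : ℝ → Matrix (Fin n ⊕ Fin n) (Fin n ⊕ Fin n) ℂ)
    (hΦ : ∀ x ∈ Ioo a b, ∀ i j, HasDerivAt (fun t => Φ t i j) (DΦ x i j) x)
    (hODE : ∀ x ∈ Ioo a b, stdJ n * DΦ x = (B0 x + lam • B1 x) * Φ x)
    (hΦc : Φ c = 1)
    (hΦinv : ∀ x ∈ Ioo a b, IsUnit (Φ x)) :
    ∀ x ∈ Ioo a b, ∃ h : (calA n lam Φ x).IsHermitian,
      IsUnit (calA n lam Φ x) ∧
      Nat.card {i : Fin n ⊕ Fin n // 0 < h.eigenvalues i} = n ∧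
      Nat.card {i : Fin n ⊕ Fin n // h.eigenvalues i < 0} = n := by
  intro x hx
  have h := calA_isHermitian n lam Φ x
  refine ⟨h, calA_isUnit n hlam (hΦinv x hx), ?_⟩
  have hp := le_card_eigenvalues_calA n hlam (hΦinv x hx) h (inv_ne_zero hlam)
  have hn := le_card_eigenvalues_calA n hlam (hΦinv x hx) h (neg_ne_zero.mpr (inv_ne_zero hlam))
  simp only [neg_mul, inv_mul_cancel₀ hlam, one_mul, Left.neg_pos_iff] at hp hn
  have hsum : Nat.card {i // 0 < h.eigenvalues i} + Nat.card {i // h.eigenvalues i < 0} ≤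
      2 * n := by
    classical
    have hdisj : Disjoint (fun i => 0 < h.eigenvalues i) (fun i => h.eigenvalues i < 0) :=
      Pi.disjoint_iff.mpr fun i => by
        simpa [Prop.disjoint_iff] using fun hi : 0 < h.eigenvalues i => hi.le
    rw [Nat.card_eq_fintype_card, Nat.card_eq_fintype_card,
      ← Fintype.card_subtype_or_disjoint _ _ hdisj]
    exact (Fintype.card_subtype_le _).trans (by simp [two_mul])
  omega
end
end
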